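/- arXiv:math/0504491 — 8 statements merged into one kernel-verified Lean document; each statement's English description precedes it below -/
import Mathlib

section
/- Let P̃ and Q̃ be homogeneous polynomials in the three variables x, y, z over ℝ of the same degree m. Then the vector field N on ℝ³ defined by N(x,y,z) = (−z·Q̃(x,y,z), z·P̃(x,y,z), x·Q̃(x,y,z) − y·P̃(x,y,z)) is holonomic, i.e. ⟨N, curl N⟩ = 0 identically on ℝ³. -/
/-- Evaluation of a polynomial in three variables at the point `(x, y, z)`. -/
noncomputable def evalPoly3 (P : MvPolynomial (Fin 3) ℝ) (x y z : ℝ) : ℝ :=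
  MvPolynomial.eval ![x, y, z] P

/-- First component of the projective-extension vector field:  `−z·Q̃(x,y,z)`. -/
noncomputable def projN₁ (P Q : MvPolynomial (Fin 3) ℝ) (x y z : ℝ) : ℝ :=
  -z * evalPoly3 Q x y z

/-- Second component:  `z·P̃(x,y,z)`. -/
noncomputable def projN₂ (P Q : MvPolynomial (Fin 3) ℝ) (x y z : ℝ) : ℝ :=
  z * evalPoly3 P x y z

/-- Third component:  `x·Q̃(x,y,z) − y·P̃(x,y,z)`. -/
noncomputable def projN₃ (P Q : MvPolynomial (Fin 3) ℝ) (x y z : ℝ) : ℝ :=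
  x * evalPoly3 Q x y z - y * evalPoly3 P x y z

theorem hasDerivAt_evalPoly3_aux (P : MvPolynomial (Fin 3) ℝ) (g : ℝ → Fin 3 → ℝ)
    (g' : Fin 3 → ℝ) (t : ℝ) (hg : ∀ i, HasDerivAt (fun s => g s i) (g' i) t) :
    HasDerivAt (fun s => MvPolynomial.eval (g s) P)
      (∑ i, g' i * MvPolynomial.eval (g t) (MvPolynomial.pderiv i P)) t := by
  induction P using MvPolynomial.induction_on with
  | C a => simpa using hasDerivAt_const t a
  | add p q hp hq =>
    simp only [map_add, mul_add, Finset.sum_add_distrib]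
    exact hp.add hq
  | mul_X p j hp =>
    have h := hp.mul (hg j)
    simp only [map_mul, MvPolynomial.eval_X]
    refine h.congr_deriv ?_
    simp only [Derivation.leibniz, MvPolynomial.pderiv_X, smul_eq_mul, map_add, map_mul,
      MvPolynomial.eval_X, Fin.sum_univ_three]
    fin_cases j <;> simp [Pi.single_apply] <;> ring

theorem euler_evalPoly3_aux (m : ℕ) (P : MvPolynomial (Fin 3) ℝ) (hP : P.IsHomogeneous m)
    (x y z : ℝ) :
    x * evalPoly3 (MvPolynomial.pderiv 0 P) x y z + y * evalPoly3 (MvPolynomial.pderiv 1 P) x y z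
      + z * evalPoly3 (MvPolynomial.pderiv 2 P) x y z = m * evalPoly3 P x y z := by
  have h := congrArg (MvPolynomial.eval ![x, y, z]) hP.sum_X_mul_pderiv
  simpa [Fin.sum_univ_three, evalPoly3] using h

theorem hasDerivAt_x_aux (P : MvPolynomial (Fin 3) ℝ) (x y z : ℝ) :
    HasDerivAt (fun t => evalPoly3 P t y z) (evalPoly3 (MvPolynomial.pderiv 0 P) x y z) x := by
  have h := hasDerivAt_evalPoly3_aux P (fun t => ![t, y, z]) ![1, 0, 0] x (by
    intro i; fin_cases i
    · exact hasDerivAt_id x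
    · exact hasDerivAt_const x y
    · exact hasDerivAt_const x z)
  simpa [Fin.sum_univ_three, evalPoly3] using h

theorem hasDerivAt_y_aux (P : MvPolynomial (Fin 3) ℝ) (x y z : ℝ) :
    HasDerivAt (fun t => evalPoly3 P x t z) (evalPoly3 (MvPolynomial.pderiv 1 P) x y z) y := by
  have h := hasDerivAt_evalPoly3_aux P (fun t => ![x, t, z]) ![0, 1, 0] y (by
    intro i; fin_cases i
    · exact hasDerivAt_const y x
    · exact hasDerivAt_id y
    · exact hasDerivAt_const y z)
  simpa [Fin.sum_univ_three, evalPoly3] using h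

theorem hasDerivAt_z_aux (P : MvPolynomial (Fin 3) ℝ) (x y z : ℝ) :
    HasDerivAt (fun t => evalPoly3 P x y t) (evalPoly3 (MvPolynomial.pderiv 2 P) x y z) z := by
  have h := hasDerivAt_evalPoly3_aux P (fun t => ![x, y, t]) ![0, 0, 1] z (by
    intro i; fin_cases i
    · exact hasDerivAt_const z x
    · exact hasDerivAt_const z y
    · exact hasDerivAt_id z)
  simpa [Fin.sum_univ_three, evalPoly3] using h

/-- If `P̃` and `Q̃` are homogeneous polynomials of the same degree `m` in `x, y, z`, then
the vector field `N = (−z·Q̃, z·P̃, x·Q̃ − y·P̃)` on `ℝ³` is holonomic: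
`⟨N, curl N⟩ = 0` identically. -/
theorem projective_extension_holonomic (m : ℕ) (P Q : MvPolynomial (Fin 3) ℝ)
    (hP : P.IsHomogeneous m) (hQ : Q.IsHomogeneous m) (x y z : ℝ) :
    projN₁ P Q x y z *
        (deriv (fun t => projN₃ P Q x t z) y - deriv (fun t => projN₂ P Q x y t) z) +
      projN₂ P Q x y z *
        (deriv (fun t => projN₁ P Q x y t) z - deriv (fun t => projN₃ P Q t y z) x) +
      projN₃ P Q x y z *
        (deriv (fun t => projN₂ P Q t y z) x - deriv (fun t => projN₁ P Q x t z) y) = 0 := by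
  have eP := euler_evalPoly3_aux m P hP x y z
  have eQ := euler_evalPoly3_aux m Q hQ x y z
  have d1 := (((hasDerivAt_y_aux Q x y z).const_mul x).sub
    ((hasDerivAt_id' y).mul (hasDerivAt_y_aux P x y z))).deriv
  have d2 := ((hasDerivAt_id' z).mul (hasDerivAt_z_aux P x y z)).deriv
  have d3 := ((hasDerivAt_id' z).neg.mul (hasDerivAt_z_aux Q x y z)).deriv
  have d4 := (((hasDerivAt_id' x).mul (hasDerivAt_x_aux Q x y z)).sub
    ((hasDerivAt_x_aux P x y z).const_mul y)).deriv
  have d5 := ((hasDerivAt_x_aux P x y z).const_mul z).deriv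
  have d6 := ((hasDerivAt_y_aux Q x y z).const_mul (-z)).deriv
  have D1 : deriv (fun t => projN₃ P Q x t z) y = _ := d1
  have D2 : deriv (fun t => projN₂ P Q x y t) z = _ := d2
  have D3 : deriv (fun t => projN₁ P Q x y t) z = _ := d3
  have D4 : deriv (fun t => projN₃ P Q t y z) x = _ := d4
  have D5 : deriv (fun t => projN₂ P Q t y z) x = _ := d5
  have D6 : deriv (fun t => projN₁ P Q x t z) y = _ := d6
  rw [D1, D2, D3, D4, D5, D6]
  simp only [projN₁, projN₂, projN₃, Pi.neg_apply]
  linear_combination z * evalPoly3 Q x y z * eP - z * evalPoly3 P x y z * eQ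
end

section
/- Let k, l, m, n, a, b, c, e, f, h be real parameters and define on ℝ³ the vector field N = (P, Q, R) with P(x,y,z) = (−ny − mx)z² + (−hy² − fxy − ex²)z, Q(x,y,z) = (ly + kx)z² + (cy² + bxy + ax²)z, and R(x,y,z) = (−ly² + (n−k)xy + mx²)z − cy³ + (h−b)xy² + (f−a)x²y + ex³. Then ⟨N, curl N⟩ = 0 identically on ℝ³, i.e. N is holonomic. -/
/-- First component of the projective extension of a general quadratic planar system. -/
def quadN₁ (k l m n a b c e f h x y z : ℝ) : ℝ :=
  (-n * y - m * x) * z ^ 2 + (-h * y ^ 2 - f * x * y - e * x ^ 2) * z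

/-- Second component. -/
def quadN₂ (k l m n a b c e f h x y z : ℝ) : ℝ :=
  (l * y + k * x) * z ^ 2 + (c * y ^ 2 + b * x * y + a * x ^ 2) * z

/-- Third component. -/
def quadN₃ (k l m n a b c e f h x y z : ℝ) : ℝ :=
  (-l * y ^ 2 + (n - k) * x * y + m * x ^ 2) * z - c * y ^ 3 + (h - b) * x * y ^ 2 +
    (f - a) * x ^ 2 * y + e * x ^ 3

theorem cubic_deriv_aux (g : ℝ → ℝ) (A B C D u : ℝ)
    (hg : ∀ t, g t = A + B * t + C * t ^ 2 + D * t ^ 3) :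
    deriv g u = B + 2 * C * u + 3 * D * u ^ 2 := by
  have hfun : g = fun t => A + B * t + C * t ^ 2 + D * t ^ 3 := funext hg
  rw [hfun]
  have h1 := (((hasDerivAt_id u).const_mul B).const_add A).add
    (((hasDerivAt_id u).pow 2).const_mul C)
  have h2 := h1.add (((hasDerivAt_id u).pow 3).const_mul D)
  have h3 : HasDerivAt (fun t => A + B * t + C * t ^ 2 + D * t ^ 3)
      (B + 2 * C * u + 3 * D * u ^ 2) u := by
    refine h2.congr_deriv ?_
    simp
    ring
  exact h3.deriv

/-- The vector field `N = (P, Q, R)` obtained by projective extension of the general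
quadratic planar system is holonomic: `⟨N, curl N⟩ = 0` identically on `ℝ³`. -/
theorem quadratic_projective_extension_holonomic (k l m n a b c e f h x y z : ℝ) :
    quadN₁ k l m n a b c e f h x y z *
        (deriv (fun t => quadN₃ k l m n a b c e f h x t z) y -
          deriv (fun t => quadN₂ k l m n a b c e f h x y t) z) +
      quadN₂ k l m n a b c e f h x y z *
        (deriv (fun t => quadN₁ k l m n a b c e f h x y t) z -
          deriv (fun t => quadN₃ k l m n a b c e f h t y z) x) +
      quadN₃ k l m n a b c e f h x y z *
        (deriv (fun t => quadN₂ k l m n a b c e f h t y z) x -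
          deriv (fun t => quadN₁ k l m n a b c e f h x t z) y) = 0 := by
  have d1 := cubic_deriv_aux (fun t => quadN₃ k l m n a b c e f h x t z)
    (m * x ^ 2 * z + e * x ^ 3) ((n - k) * x * z + (f - a) * x ^ 2)
    (-l * z + (h - b) * x) (-c) y (fun t => by simp only [quadN₃]; ring)
  have d2 := cubic_deriv_aux (fun t => quadN₂ k l m n a b c e f h x y t)
    0 (c * y ^ 2 + b * x * y + a * x ^ 2) (l * y + k * x) 0 z
    (fun t => by simp only [quadN₂]; ring)
  have d3 := cubic_deriv_aux (fun t => quadN₁ k l m n a b c e f h x y t)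
    0 (-h * y ^ 2 - f * x * y - e * x ^ 2) (-n * y - m * x) 0 z
    (fun t => by simp only [quadN₁]; ring)
  have d4 := cubic_deriv_aux (fun t => quadN₃ k l m n a b c e f h t y z)
    (-l * y ^ 2 * z - c * y ^ 3) ((n - k) * y * z + (h - b) * y ^ 2)
    (m * z + (f - a) * y) e x (fun t => by simp only [quadN₃]; ring)
  have d5 := cubic_deriv_aux (fun t => quadN₂ k l m n a b c e f h t y z)
    (l * y * z ^ 2 + c * y ^ 2 * z) (k * z ^ 2 + b * y * z) (a * z) 0 x
    (fun t => by simp only [quadN₂]; ring)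
  have d6 := cubic_deriv_aux (fun t => quadN₁ k l m n a b c e f h x t z)
    (-m * x * z ^ 2 - e * x ^ 2 * z) (-n * z ^ 2 - f * x * z) (-h * z) 0 y
    (fun t => by simp only [quadN₁]; ring)
  rw [d1, d2, d3, d4, d5, d6]
  simp only [quadN₁, quadN₂, quadN₃]
  ring
end

section
/- Let P, Q, R : ℝ³ → ℝ be C¹ functions and let x, y, z : I → ℝ be C² functions on an interval I such that Δ(s) := P² + Q² + R² (evaluated along the curve) is nonzero on I, and such that the geodesic equations of the first kind hold: x'' + (P/Δ)·S = 0, y'' + (Q/Δ)·S = 0, z'' + (R/Δ)·S = 0, where S(s) = x'·(d/ds)P(x,y,z) + y'·(d/ds)Q(x,y,z) + z'·(d/ds)R(x,y,z). Then the function s ↦ P(x(s),y(s),z(s))·x'(s) + Q(x(s),y(s),z(s))·y'(s) + R(x(s),y(s),z(s))·z'(s) has identically vanishing derivative on I (so in particular, if it vanishes at one point it vanishes identically, i.e. the Pfaff constraint P dx + Q dy + R dz = 0 is preserved along geodesics of the first kind). -/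
/-- Along any geodesic of the first kind of the Pfaff equation `P dx + Q dy + R dz = 0`
(with `Δ = P² + Q² + R²` nonvanishing along the curve), the derivative of
`s ↦ P x' + Q y' + R z'` vanishes identically: the Pfaff constraint is preserved. -/
theorem pfaff_preserved_along_first_kind_geodesics
    (P Q R : ℝ × ℝ × ℝ → ℝ)
    (hP : ContDiff ℝ 1 P) (hQ : ContDiff ℝ 1 Q) (hR : ContDiff ℝ 1 R)
    (I : Set ℝ) (hIopen : IsOpen I) (hIinterval : I.OrdConnected)
    (x y z : ℝ → ℝ)
    (hx : ContDiffOn ℝ 2 x I) (hy : ContDiffOn ℝ 2 y I) (hz : ContDiffOn ℝ 2 z I)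
    (hΔ : ∀ s ∈ I,
      P (x s, y s, z s) ^ 2 + Q (x s, y s, z s) ^ 2 + R (x s, y s, z s) ^ 2 ≠ 0)
    -- the geodesic equations of the first kind:
    (hgeo₁ : ∀ s ∈ I,
      deriv (deriv x) s +
        P (x s, y s, z s) /
            (P (x s, y s, z s) ^ 2 + Q (x s, y s, z s) ^ 2 + R (x s, y s, z s) ^ 2) *
          (deriv x s * deriv (fun t => P (x t, y t, z t)) s +
            deriv y s * deriv (fun t => Q (x t, y t, z t)) s +
            deriv z s * deriv (fun t => R (x t, y t, z t)) s) = 0)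
    (hgeo₂ : ∀ s ∈ I,
      deriv (deriv y) s +
        Q (x s, y s, z s) /
            (P (x s, y s, z s) ^ 2 + Q (x s, y s, z s) ^ 2 + R (x s, y s, z s) ^ 2) *
          (deriv x s * deriv (fun t => P (x t, y t, z t)) s +
            deriv y s * deriv (fun t => Q (x t, y t, z t)) s +
            deriv z s * deriv (fun t => R (x t, y t, z t)) s) = 0)
    (hgeo₃ : ∀ s ∈ I,
      deriv (deriv z) s +
        R (x s, y s, z s) /
            (P (x s, y s, z s) ^ 2 + Q (x s, y s, z s) ^ 2 + R (x s, y s, z s) ^ 2) *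
          (deriv x s * deriv (fun t => P (x t, y t, z t)) s +
            deriv y s * deriv (fun t => Q (x t, y t, z t)) s +
            deriv z s * deriv (fun t => R (x t, y t, z t)) s) = 0) :
    ∀ s ∈ I,
      deriv (fun t =>
        P (x t, y t, z t) * deriv x t + Q (x t, y t, z t) * deriv y t +
          R (x t, y t, z t) * deriv z t) s = 0 := by
  intro s hs
  have d1 : ∀ f : ℝ → ℝ, ContDiffOn ℝ 2 f I → DifferentiableAt ℝ f s := fun f hf =>
    (hf.differentiableOn (by norm_num)).differentiableAt (hIopen.mem_nhds hs)
  have d2 : ∀ f : ℝ → ℝ, ContDiffOn ℝ 2 f I → DifferentiableAt ℝ (deriv f) s := by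
    intro f hf
    have h : ContDiffOn ℝ 1 (deriv f) I := hf.deriv_of_isOpen hIopen (by norm_num)
    exact (h.differentiableOn (by norm_num)).differentiableAt (hIopen.mem_nhds hs)
  have d3 : ∀ F : ℝ × ℝ × ℝ → ℝ, ContDiff ℝ 1 F →
      DifferentiableAt ℝ (fun t => F (x t, y t, z t)) s := by
    intro F hF
    have h : DifferentiableAt ℝ F (x s, y s, z s) := (hF.differentiable (by norm_num)) _
    have hc : DifferentiableAt ℝ (fun t => (x t, y t, z t)) s :=
      (d1 x hx).prodMk ((d1 y hy).prodMk (d1 z hz))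
    exact DifferentiableAt.comp (f := fun t => (x t, y t, z t)) s h hc
  have H := (((d3 P hP).hasDerivAt.mul (d2 x hx).hasDerivAt).add
    ((d3 Q hQ).hasDerivAt.mul (d2 y hy).hasDerivAt)).add
    ((d3 R hR).hasDerivAt.mul (d2 z hz).hasDerivAt)
  refine (HasDerivAt.deriv H).trans ?_
  have h0 := hΔ s hs
  rw [eq_neg_of_add_eq_zero_left (hgeo₁ s hs), eq_neg_of_add_eq_zero_left (hgeo₂ s hs),
    eq_neg_of_add_eq_zero_left (hgeo₃ s hs)]
  generalize deriv (fun t => P (x t, y t, z t)) s = p'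
  generalize deriv (fun t => Q (x t, y t, z t)) s = q'
  generalize deriv (fun t => R (x t, y t, z t)) s = r'
  field_simp
  ring
end

section
/- Let a, b, c be real parameters and consider the vector field F = (ayz, bxz, cxy) on ℝ³. Let x, y, z : I → ℝ be C² functions on an interval I with Δ(s) = a²y²z² + b²z²x² + c²x²y² nonzero along the curve, satisfying the geodesic system: x'' + [ayzx(c+b)·y'z' + ay²z(a+c)·x'z' + ayz²(a+b)·x'y']/Δ = 0, y'' + [bx²z(c+b)·y'z' + bxzy(a+c)·x'z' + bxz²(a+b)·x'y']/Δ = 0, z'' + [cx²y(c+b)·y'z' + cxy²(a+c)·x'z' + cxyz(a+b)·x'y']/Δ = 0. Then the quantity W(s) = a·y(s)z(s)·x'(s) + b·x(s)z(s)·y'(s) + c·x(s)y(s)·z'(s) is constant on I; in particular the relation a y z x' + b x z y' + c x y z' = 0 is an integral of the system. -/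
/-- For the geodesics of the first kind associated with the holonomic vector field
`F = (ayz, bxz, cxy)` on `ℝ³`, the quantity `W = a y z x' + b x z y' + c x y z'`
is constant along the curve; in particular `a y z x' + b x z y' + c x y z' = 0`
is an integral of the system. -/
theorem first_kind_geodesic_integral_ayz_bxz_cxy
    (a b c : ℝ)
    (I : Set ℝ) (hIopen : IsOpen I) (hIinterval : I.OrdConnected)
    (x y z : ℝ → ℝ)
    (hx : ContDiffOn ℝ 2 x I) (hy : ContDiffOn ℝ 2 y I) (hz : ContDiffOn ℝ 2 z I)
    (hΔ : ∀ s ∈ I,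
      a ^ 2 * (y s) ^ 2 * (z s) ^ 2 + b ^ 2 * (z s) ^ 2 * (x s) ^ 2 +
        c ^ 2 * (x s) ^ 2 * (y s) ^ 2 ≠ 0)
    -- the geodesic system:
    (hgeo₁ : ∀ s ∈ I,
      deriv (deriv x) s +
        (a * y s * z s * x s * (c + b) * (deriv y s * deriv z s) +
          a * (y s) ^ 2 * z s * (a + c) * (deriv x s * deriv z s) +
          a * y s * (z s) ^ 2 * (a + b) * (deriv x s * deriv y s)) /
        (a ^ 2 * (y s) ^ 2 * (z s) ^ 2 + b ^ 2 * (z s) ^ 2 * (x s) ^ 2 +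
          c ^ 2 * (x s) ^ 2 * (y s) ^ 2) = 0)
    (hgeo₂ : ∀ s ∈ I,
      deriv (deriv y) s +
        (b * (x s) ^ 2 * z s * (c + b) * (deriv y s * deriv z s) +
          b * x s * z s * y s * (a + c) * (deriv x s * deriv z s) +
          b * x s * (z s) ^ 2 * (a + b) * (deriv x s * deriv y s)) /
        (a ^ 2 * (y s) ^ 2 * (z s) ^ 2 + b ^ 2 * (z s) ^ 2 * (x s) ^ 2 +
          c ^ 2 * (x s) ^ 2 * (y s) ^ 2) = 0)
    (hgeo₃ : ∀ s ∈ I,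
      deriv (deriv z) s +
        (c * (x s) ^ 2 * y s * (c + b) * (deriv y s * deriv z s) +
          c * x s * (y s) ^ 2 * (a + c) * (deriv x s * deriv z s) +
          c * x s * y s * z s * (a + b) * (deriv x s * deriv y s)) /
        (a ^ 2 * (y s) ^ 2 * (z s) ^ 2 + b ^ 2 * (z s) ^ 2 * (x s) ^ 2 +
          c ^ 2 * (x s) ^ 2 * (y s) ^ 2) = 0) :
    ∀ s ∈ I, ∀ t ∈ I,
      a * y s * z s * deriv x s + b * x s * z s * deriv y s + c * x s * y s * deriv z s =
        a * y t * z t * deriv x t + b * x t * z t * deriv y t + c * x t * y t * deriv z t := by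
  have key : ∀ f : ℝ → ℝ, ContDiffOn ℝ 2 f I → ∀ s ∈ I,
      HasDerivAt f (deriv f s) s ∧ HasDerivAt (deriv f) (deriv (deriv f) s) s := by
    intro f hf s hs
    have hn : I ∈ nhds s := hIopen.mem_nhds hs
    have h1 : ContDiffOn ℝ 1 (deriv f) I := hf.deriv_of_isOpen hIopen (by norm_num)
    exact ⟨((hf.differentiableOn (by norm_num)).differentiableAt hn).hasDerivAt,
      ((h1.differentiableOn (by norm_num)).differentiableAt hn).hasDerivAt⟩
  have hW : ∀ s ∈ I, HasDerivAt (fun s => a * y s * z s * deriv x s + b * x s * z s * deriv y s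
      + c * x s * y s * deriv z s) 0 s := by
    intro s hs
    obtain ⟨x1, x2⟩ := key x hx s hs
    obtain ⟨y1, y2⟩ := key y hy s hs
    obtain ⟨z1, z2⟩ := key z hz s hs
    have h := ((((y1.const_mul a).mul z1).mul x2).add (((x1.const_mul b).mul z1).mul y2)).add
      (((x1.const_mul c).mul y1).mul z2)
    refine h.congr_deriv ?_
    have hD := hΔ s hs
    have e1 := eq_neg_of_add_eq_zero_left (hgeo₁ s hs)
    have e2 := eq_neg_of_add_eq_zero_left (hgeo₂ s hs)
    have e3 := eq_neg_of_add_eq_zero_left (hgeo₃ s hs)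
    simp only [Pi.mul_apply]
    rw [e1, e2, e3]
    have hD' := mul_inv_cancel₀ hD
    linear_combination (-(x s * (c + b) * (deriv y s * deriv z s) +
      y s * (a + c) * (deriv x s * deriv z s) + z s * (a + b) * (deriv x s * deriv y s))) * hD'
  intro s hs t ht
  exact hIopen.is_const_of_deriv_eq_zero hIinterval.isPreconnected
    (fun u hu => (hW u hu).differentiableAt.differentiableWithinAt)
    (fun u hu => (hW u hu).deriv) hs ht
end

section
/- Let μ be a real parameter and define on ℝ³ the vector field N = (N₁, N₂, N₃) with N₁(x,y,z) = z³x + zx²y − z³μ²y, N₂(x,y,z) = yz³, N₃(x,y,z) = −x²z² − x³y + xμ²yz² − y²z². Then ⟨N, curl N⟩ = 0 identically on ℝ³, i.e. the Pfaff equation N₁dx + N₂dy + N₃dz = 0 obtained as the projective extension of the Van der Pol system is holonomic. -/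
/-- First component of the projective extension of the Van der Pol system. -/
def vdpN₁ (μ x y z : ℝ) : ℝ := z ^ 3 * x + z * x ^ 2 * y - z ^ 3 * μ ^ 2 * y

/-- Second component. -/
def vdpN₂ (μ x y z : ℝ) : ℝ := y * z ^ 3

/-- Third component. -/
def vdpN₃ (μ x y z : ℝ) : ℝ :=
  -x ^ 2 * z ^ 2 - x ^ 3 * y + x * μ ^ 2 * y * z ^ 2 - y ^ 2 * z ^ 2

theorem vdp_deriv_cubic (f : ℝ → ℝ) (a b c d s : ℝ)
    (h : ∀ t, f t = a + b * t + c * t ^ 2 + d * t ^ 3) :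
    deriv f s = b + 2 * c * s + 3 * d * s ^ 2 := by
  have hf : f = fun t => a + b * t + c * t ^ 2 + d * t ^ 3 := funext h
  have h1 := (((hasDerivAt_id' s).const_mul b).const_add a)
  have h2 := ((hasDerivAt_pow 2 s).const_mul c)
  have h3 := ((hasDerivAt_pow 3 s).const_mul d)
  have h4 := ((h1.add h2).add h3).deriv
  rw [hf]
  refine Eq.trans h4 ?_
  norm_num
  ring

/-- The Pfaff equation obtained as the projective extension of the Van der Pol system is
holonomic: `⟨N, curl N⟩ = 0` identically on `ℝ³`. -/
theorem vanderPol_projective_extension_holonomic (μ x y z : ℝ) :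
    vdpN₁ μ x y z *
        (deriv (fun t => vdpN₃ μ x t z) y - deriv (fun t => vdpN₂ μ x y t) z) +
      vdpN₂ μ x y z *
        (deriv (fun t => vdpN₁ μ x y t) z - deriv (fun t => vdpN₃ μ t y z) x) +
      vdpN₃ μ x y z *
        (deriv (fun t => vdpN₂ μ t y z) x - deriv (fun t => vdpN₁ μ x t z) y) = 0 := by
  have e0 := vdp_deriv_cubic (fun t => vdpN₃ μ x t z) (-x^2*z^2) (-x^3+x*μ^2*z^2) (-z^2) (0) y
    (by intro t; simp only [vdpN₁, vdpN₂, vdpN₃]; ring)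
  have e1 := vdp_deriv_cubic (fun t => vdpN₂ μ x y t) (0) (0) (0) (y) z
    (by intro t; simp only [vdpN₁, vdpN₂, vdpN₃]; ring)
  have e2 := vdp_deriv_cubic (fun t => vdpN₁ μ x y t) (0) (x^2*y) (0) (x-μ^2*y) z
    (by intro t; simp only [vdpN₁, vdpN₂, vdpN₃]; ring)
  have e3 := vdp_deriv_cubic (fun t => vdpN₃ μ t y z) (-y^2*z^2) (μ^2*y*z^2) (-z^2) (-y) x
    (by intro t; simp only [vdpN₁, vdpN₂, vdpN₃]; ring)
  have e4 := vdp_deriv_cubic (fun t => vdpN₂ μ t y z) (y*z^3) (0) (0) (0) x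
    (by intro t; simp only [vdpN₁, vdpN₂, vdpN₃]; ring)
  have e5 := vdp_deriv_cubic (fun t => vdpN₁ μ x t z) (z^3*x) (z*x^2-z^3*μ^2) (0) (0) y
    (by intro t; simp only [vdpN₁, vdpN₂, vdpN₃]; ring)
  rw [e0, e1, e2, e3, e4, e5]
  simp only [vdpN₁, vdpN₂, vdpN₃]
  ring
end

section
/- Let a, b be real parameters and define on ℝ³ the vector field N = (N₁, N₂, N₃) with N₁(x,y,z) = −z³x − zbyx² − zby³ + z³by, N₂(x,y,z) = −z³y + zax³ + zaxy² − z³ax, N₃(x,y,z) = x²z² + byx³ + xby³ − xbyz² + y²z² − yax³ − axy³ + yaxz². Then ⟨N, curl N⟩ = 0 identically on ℝ³, i.e. the Pfaff equation N₁dx + N₂dy + N₃dz = 0 obtained as the projective extension of the cubic system dx/ds = −y + ax(x²+y²−1), dy/ds = x + by(x²+y²−1) is holonomic. -/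
/-- First component of the projective extension of the cubic system
`dx/ds = −y + ax(x²+y²−1)`, `dy/ds = x + by(x²+y²−1)`. -/
def cubicN₁ (a b x y z : ℝ) : ℝ :=
  -z ^ 3 * x - z * b * y * x ^ 2 - z * b * y ^ 3 + z ^ 3 * b * y

/-- Second component. -/
def cubicN₂ (a b x y z : ℝ) : ℝ :=
  -z ^ 3 * y + z * a * x ^ 3 + z * a * x * y ^ 2 - z ^ 3 * a * x

/-- Third component. -/
def cubicN₃ (a b x y z : ℝ) : ℝ :=
  x ^ 2 * z ^ 2 + b * y * x ^ 3 + x * b * y ^ 3 - x * b * y * z ^ 2 + y ^ 2 * z ^ 2 -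
    y * a * x ^ 3 - a * x * y ^ 3 + y * a * x * z ^ 2

theorem cubic_deriv_aux_s11 (f : ℝ → ℝ) (c₀ c₁ c₂ c₃ t₀ : ℝ)
    (h : ∀ t, f t = c₀ + c₁ * t + c₂ * t ^ 2 + c₃ * t ^ 3) :
    deriv f t₀ = c₁ + 2 * c₂ * t₀ + 3 * c₃ * t₀ ^ 2 := by
  have hf : f = fun t => c₀ + c₁ * t + c₂ * t ^ 2 + c₃ * t ^ 3 := funext h
  rw [hf]
  have h1 := (((hasDerivAt_id t₀).const_mul c₁).const_add c₀).add
    (((hasDerivAt_id t₀).pow 2).const_mul c₂)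
  have h2 := h1.add (((hasDerivAt_id t₀).pow 3).const_mul c₃)
  refine (HasDerivAt.congr_deriv h2 ?_).deriv
  simp
  ring

/-- The Pfaff equation obtained as the projective extension of the cubic system
`dx/ds = −y + ax(x²+y²−1)`, `dy/ds = x + by(x²+y²−1)` is holonomic:
`⟨N, curl N⟩ = 0` identically on `ℝ³`. -/
theorem cubic_projective_extension_holonomic (a b x y z : ℝ) :
    cubicN₁ a b x y z *
        (deriv (fun t => cubicN₃ a b x t z) y - deriv (fun t => cubicN₂ a b x y t) z) +
      cubicN₂ a b x y z *
        (deriv (fun t => cubicN₁ a b x y t) z - deriv (fun t => cubicN₃ a b t y z) x) +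
      cubicN₃ a b x y z *
        (deriv (fun t => cubicN₂ a b t y z) x - deriv (fun t => cubicN₁ a b x t z) y) = 0 := by
  rw [cubic_deriv_aux_s11 (fun t => cubicN₃ a b x t z) (x ^ 2 * z ^ 2)
      (b * x ^ 3 - x * b * z ^ 2 - a * x ^ 3 + a * x * z ^ 2) (z ^ 2) (x * b - a * x) y
      (by intro t; simp only [cubicN₃]; ring),
    cubic_deriv_aux_s11 (fun t => cubicN₂ a b x y t) 0 (a * x ^ 3 + a * x * y ^ 2) 0 (-y - a * x) z
      (by intro t; simp only [cubicN₂]; ring),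
    cubic_deriv_aux_s11 (fun t => cubicN₁ a b x y t) 0 (-b * y * x ^ 2 - b * y ^ 3) 0 (-x + b * y) z
      (by intro t; simp only [cubicN₁]; ring),
    cubic_deriv_aux_s11 (fun t => cubicN₃ a b t y z) (y ^ 2 * z ^ 2)
      (b * y ^ 3 - b * y * z ^ 2 - a * y ^ 3 + y * a * z ^ 2) (z ^ 2) (b * y - y * a) x
      (by intro t; simp only [cubicN₃]; ring),
    cubic_deriv_aux_s11 (fun t => cubicN₂ a b t y z) (-z ^ 3 * y) (z * a * y ^ 2 - z ^ 3 * a) 0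
      (z * a) x (by intro t; simp only [cubicN₂]; ring),
    cubic_deriv_aux_s11 (fun t => cubicN₁ a b x t z) (-z ^ 3 * x) (-z * b * x ^ 2 + z ^ 3 * b) 0
      (-z * b) y (by intro t; simp only [cubicN₁]; ring)]
  simp only [cubicN₁, cubicN₂, cubicN₃]
  ring
end

section
/- Let A, a be real parameters and define on ℝ³ the vector field N = (N₁, N₂, N₃) with N₁(x,y,z) = z²x³ − z⁴ax, N₂(x,y,z) = −x⁴z − z⁴Ay + z²x²y, N₃(x,y,z) = ax²z³ − x⁴z + Ay²z³ − zx²y² + yx⁴. Then ⟨N, curl N⟩ = 0 identically on ℝ³, i.e. the Pfaff equation N₁dx + N₂dy + N₃dz = 0 obtained as the projective extension of the quartic system dx/ds = −Ay + yx² − x⁴, dy/ds = ax − x³ is holonomic. -/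
/-- First component of the projective extension of the quartic system
`dx/ds = −Ay + yx² − x⁴`, `dy/ds = ax − x³`. -/
def quarticN₁ (A a x y z : ℝ) : ℝ := z ^ 2 * x ^ 3 - z ^ 4 * a * x

/-- Second component. -/
def quarticN₂ (A a x y z : ℝ) : ℝ := -x ^ 4 * z - z ^ 4 * A * y + z ^ 2 * x ^ 2 * y

/-- Third component. -/
def quarticN₃ (A a x y z : ℝ) : ℝ :=
  a * x ^ 2 * z ^ 3 - x ^ 4 * z + A * y ^ 2 * z ^ 3 - z * x ^ 2 * y ^ 2 + y * x ^ 4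

/-- The Pfaff equation obtained as the projective extension of the quartic system
`dx/ds = −Ay + yx² − x⁴`, `dy/ds = ax − x³` is holonomic:
`⟨N, curl N⟩ = 0` identically on `ℝ³`. -/
theorem quartic_projective_extension_holonomic (A a x y z : ℝ) :
    quarticN₁ A a x y z *
        (deriv (fun t => quarticN₃ A a x t z) y - deriv (fun t => quarticN₂ A a x y t) z) +
      quarticN₂ A a x y z *
        (deriv (fun t => quarticN₁ A a x y t) z - deriv (fun t => quarticN₃ A a t y z) x) +
      quarticN₃ A a x y z *
        (deriv (fun t => quarticN₂ A a t y z) x -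
          deriv (fun t => quarticN₁ A a x t z) y) = 0 := by
  have h3y : HasDerivAt (fun t => quarticN₃ A a x t z)
      (2 * A * y * z ^ 3 - 2 * z * x ^ 2 * y + x ^ 4) y := by
    unfold quarticN₃
    have h := hasDerivAt_id' y
    have h2 := hasDerivAt_pow 2 y
    refine ((((h2.const_mul A).mul_const (z ^ 3)).const_add (a * x ^ 2 * z ^ 3 - x ^ 4 * z)).sub
      (h2.const_mul (z * x ^ 2))).add (h.mul_const (x ^ 4)) |>.congr_deriv ?_
    push_cast; ring
  have h2z : HasDerivAt (fun t => quarticN₂ A a x y t)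
      (-x ^ 4 - 4 * z ^ 3 * A * y + 2 * z * x ^ 2 * y) z := by
    unfold quarticN₂
    refine ((((hasDerivAt_id' z).const_mul (-x ^ 4)).sub
      (((hasDerivAt_pow 4 z).mul_const A).mul_const y)).add
      (((hasDerivAt_pow 2 z).mul_const (x ^ 2)).mul_const y)).congr_deriv ?_
    push_cast; ring
  have h1z : HasDerivAt (fun t => quarticN₁ A a x y t)
      (2 * z * x ^ 3 - 4 * z ^ 3 * a * x) z := by
    unfold quarticN₁
    refine (((hasDerivAt_pow 2 z).mul_const (x ^ 3)).sub
      (((hasDerivAt_pow 4 z).mul_const a).mul_const x)).congr_deriv ?_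
    push_cast; ring
  have h3x : HasDerivAt (fun t => quarticN₃ A a t y z)
      (2 * a * x * z ^ 3 - 4 * x ^ 3 * z - 2 * z * x * y ^ 2 + 4 * y * x ^ 3) x := by
    unfold quarticN₃
    have h2 := hasDerivAt_pow 2 x
    have h4 := hasDerivAt_pow 4 x
    refine ((((((h2.const_mul a).mul_const (z ^ 3)).sub (h4.mul_const z)).add_const
      (A * y ^ 2 * z ^ 3)).sub ((h2.const_mul z).mul_const (y ^ 2))).add
      (h4.const_mul y)).congr_deriv ?_
    push_cast; ring
  have h2x : HasDerivAt (fun t => quarticN₂ A a t y z)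
      (-4 * x ^ 3 * z + 2 * z ^ 2 * x * y) x := by
    unfold quarticN₂
    refine (((((hasDerivAt_pow 4 x).neg).mul_const z).sub_const (z ^ 4 * A * y)).add
      (((hasDerivAt_pow 2 x).const_mul (z ^ 2)).mul_const y)).congr_deriv ?_
    push_cast; ring
  have h1y : HasDerivAt (fun t => quarticN₁ A a x t z) 0 y := by
    unfold quarticN₁
    exact hasDerivAt_const _ _
  rw [h3y.deriv, h2z.deriv, h1z.deriv, h3x.deriv, h2x.deriv, h1y.deriv]
  unfold quarticN₁ quarticN₂ quarticN₃
  ring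
end

section
/- Let μ be a real parameter and consider the quadratic planar system dx/ds = p(x,y) = 5x + 6x² + 4(1+μ)xy + μy², dy/ds = q(x,y) = x + 2y + 4xy + (2+3μ)y². Then the algebraic curve F(x,y) = x² + x³ + x²y + 2μxy² + 2μxy³ + μ²y⁴ = 0 is invariant for this system: there exists a polynomial K(x,y) with real coefficients such that p·∂F/∂x + q·∂F/∂y = K·F identically in x and y. -/
open MvPolynomial

/-- Right-hand side `p(x,y) = 5x + 6x² + 4(1+μ)xy + μy²` of the quadratic system. -/
noncomputable def quadSysP (μ : ℝ) : MvPolynomial (Fin 2) ℝ :=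
  C 5 * X 0 + C 6 * X 0 ^ 2 + C (4 * (1 + μ)) * X 0 * X 1 + C μ * X 1 ^ 2

/-- Right-hand side `q(x,y) = x + 2y + 4xy + (2+3μ)y²` of the quadratic system. -/
noncomputable def quadSysQ (μ : ℝ) : MvPolynomial (Fin 2) ℝ :=
  X 0 + C 2 * X 1 + C 4 * X 0 * X 1 + C (2 + 3 * μ) * X 1 ^ 2

/-- The algebraic curve `F(x,y) = x² + x³ + x²y + 2μxy² + 2μxy³ + μ²y⁴`. -/
noncomputable def quadSysF (μ : ℝ) : MvPolynomial (Fin 2) ℝ :=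
  X 0 ^ 2 + X 0 ^ 3 + X 0 ^ 2 * X 1 + C (2 * μ) * X 0 * X 1 ^ 2 +
    C (2 * μ) * X 0 * X 1 ^ 3 + C (μ ^ 2) * X 1 ^ 4

/-- The curve `F = x² + x³ + x²y + 2μxy² + 2μxy³ + μ²y⁴ = 0` is an invariant algebraic
curve for the quadratic system `dx/ds = 5x + 6x² + 4(1+μ)xy + μy²`,
`dy/ds = x + 2y + 4xy + (2+3μ)y²`: the derivative of `F` along the vector field is a
polynomial multiple of `F`. -/
theorem quadratic_system_invariant_algebraic_curve (μ : ℝ) :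
    ∃ K : MvPolynomial (Fin 2) ℝ,
      quadSysP μ * pderiv 0 (quadSysF μ) + quadSysQ μ * pderiv 1 (quadSysF μ) =
        K * quadSysF μ := by
  refine ⟨C 10 + C 18 * X 0 + C (10 + 12 * μ) * X 1, ?_⟩
  have h01 : pderiv (R := ℝ) (0 : Fin 2) (X 1) = 0 := pderiv_X_of_ne (by decide)
  have h10 : pderiv (R := ℝ) (1 : Fin 2) (X 0) = 0 := pderiv_X_of_ne (by decide)
  have hn : ∀ n : ℕ, [n.AtLeastTwo] →
      (C (OfNat.ofNat n : ℝ) : MvPolynomial (Fin 2) ℝ) = OfNat.ofNat n :=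
    fun n _ => map_ofNat C n
  have h2 : ∀ i : Fin 2, pderiv i (2 : MvPolynomial (Fin 2) ℝ) = 0 := fun i => by
    rw [← hn 2]; exact pderiv_C
  simp only [quadSysP, quadSysQ, quadSysF, map_add, pderiv_mul, pderiv_pow, pderiv_C,
    pderiv_X_self, h01, h10, map_mul, map_pow, map_one, hn, h2]
  norm_num
  ring
end
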